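/- Let Δ be a co-Hopfian group with no free cyclic (ℤ) free factor, and let Γ = Δ ∗ ℤ with the ℤ factor generated by t. If φ is an automorphism of Γ with φ(Δ) = Δ, then there exist δ₁, δ₂ ∈ Δ such that φ(t) = δ₁ t^{±1} δ₂. -/

import Mathlib

open Monoid

/-- `G` is co-Hopfian: every injective endomorphism is surjective. -/
def CoHopfian (G : Type*) [Group G] : Prop :=
  ∀ φ : G →* G, Function.Injective φ → Function.Surjective φ

/-- The generator `t` of the `ℤ` free factor of `Δ ∗ ℤ`. -/
def tGen (Δ : Type) [Group Δ] : Coprod Δ (Multiplicative ℤ) :=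
  Coprod.inr (Multiplicative.ofAdd 1)


namespace FPZ

abbrev Z := Multiplicative ℤ

def Fam (Δ : Type) : Bool → Type
  | true => Δ
  | false => Z

instance (Δ : Type) [Group Δ] : ∀ b, Group (Fam Δ b)
  | true => inferInstanceAs (Group Δ)
  | false => inferInstanceAs (Group Z)

variable {Δ : Type} [Group Δ]

def ofL : Δ →* CoprodI (Fam Δ) := (CoprodI.of : Fam Δ true →* CoprodI (Fam Δ))
def ofR : Z →* CoprodI (Fam Δ) := (CoprodI.of : Fam Δ false →* CoprodI (Fam Δ))

def F : Coprod Δ Z →* CoprodI (Fam Δ) := Coprod.lift ofL ofR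

def comp : ∀ b, Fam Δ b →* Coprod Δ Z
  | true => (Coprod.inl : Δ →* Coprod Δ Z)
  | false => (Coprod.inr : Z →* Coprod Δ Z)

def B : CoprodI (Fam Δ) →* Coprod Δ Z := CoprodI.lift comp

lemma B_of (b) (x : Fam Δ b) : B (CoprodI.of x) = comp b x := by simp [B]

lemma BF (x : Coprod Δ Z) : B (F x) = x := by
  have : (B.comp F : Coprod Δ Z →* _) = MonoidHom.id _ := by
    apply Coprod.hom_ext
    · ext d; exact B_of true d
    · apply MonoidHom.ext; intro d; exact B_of false d
  exact DFunLike.congr_fun this x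

lemma F_inj : Function.Injective (F : Coprod Δ Z → _) :=
  Function.LeftInverse.injective BF

def Red (i j : Bool) (n : ℕ) (x : Coprod Δ Z) : Prop :=
  ∃ w : CoprodI.NeWord (Fam Δ) i j, w.toList.length = n ∧ w.prod = F x

lemma Red.mul {i j k l n m} {x y : Coprod Δ Z} (hx : Red i j n x) (h : j ≠ k)
    (hy : Red k l m y) : Red i l (n + m) (x * y) := by
  obtain ⟨w, rfl, hw⟩ := hx
  obtain ⟨v, rfl, hv⟩ := hy
  exact ⟨w.append h v, by simp, by simp [hw, hv]⟩

lemma len_inv {i j} (w : CoprodI.NeWord (Fam Δ) i j) :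
    w.inv.toList.length = w.toList.length := by
  induction w with
  | singleton => simp [CoprodI.NeWord.inv]
  | append w₁ h w₂ h1 h2 => simp [CoprodI.NeWord.inv, h1, h2, add_comm]

lemma Red.inv {i j n} {x : Coprod Δ Z} (hx : Red i j n x) : Red j i n x⁻¹ := by
  obtain ⟨w, rfl, hw⟩ := hx
  exact ⟨w.inv, len_inv w, by simp [hw]⟩

lemma Red.pos {i j n} {x : Coprod Δ Z} (hx : Red i j n x) : 0 < n := by
  obtain ⟨w, rfl, hw⟩ := hx
  exact List.length_pos_iff.2 w.toList_ne_nil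

lemma prod_inj : Function.Injective (CoprodI.Word.prod : CoprodI.Word (Fam Δ) → _) := by
  classical
  have : ∀ b, DecidableEq (Fam Δ b) := fun b => Classical.decEq _
  exact (CoprodI.Word.equiv (M := Fam Δ)).symm.injective

lemma Red.uniq {i j n i' j' n'} {x : Coprod Δ Z} (hx : Red i j n x) (hx' : Red i' j' n' x) :
    i = i' ∧ j = j' ∧ n = n' := by
  obtain ⟨w, rfl, hw⟩ := hx
  obtain ⟨v, rfl, hv⟩ := hx'
  have h : w.toWord = v.toWord := prod_inj (hw.trans hv.symm)
  have h2 : w.toList = v.toList := congrArg CoprodI.Word.toList h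
  have h3 := w.toList_head?
  have h4 := w.toList_getLast?
  rw [h2, v.toList_head?] at h3
  rw [h2, v.toList_getLast?] at h4
  have e3 := congrArg Sigma.fst (Option.some.inj h3)
  have e4 := congrArg Sigma.fst (Option.some.inj h4)
  exact ⟨e3.symm, e4.symm, by rw [h2]⟩

lemma Red.ex {x : Coprod Δ Z} (hx : x ≠ 1) : ∃ i j n, Red i j n x := by
  classical
  have : ∀ b, DecidableEq (Fam Δ b) := fun b => Classical.decEq _
  obtain ⟨w, hw⟩ := (CoprodI.Word.equiv (M := Fam Δ)).symm.surjective (F x)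
  change w.prod = F x at hw
  have hne : w ≠ CoprodI.Word.empty := by
    rintro rfl
    rw [CoprodI.Word.prod_empty] at hw
    exact hx (F_inj (by rw [← hw, map_one]))
  obtain ⟨i, j, v, rfl⟩ := CoprodI.NeWord.of_word w hne
  exact ⟨i, j, _, v, rfl, hw⟩

lemma Red.inl {d : Δ} (hd : d ≠ 1) : Red true true 1 (Coprod.inl d : Coprod Δ Z) :=
  ⟨CoprodI.NeWord.singleton (M := Fam Δ) (i := true) d hd, rfl,
    CoprodI.NeWord.prod_singleton (M := Fam Δ) (i := true) d hd⟩

lemma Red.inr {d : Z} (hd : d ≠ 1) : Red false false 1 (Coprod.inr d : Coprod Δ Z) :=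
  ⟨CoprodI.NeWord.singleton (M := Fam Δ) (i := false) d hd, rfl,
    CoprodI.NeWord.prod_singleton (M := Fam Δ) (i := false) d hd⟩

lemma Red.ind (P : Bool → Bool → ℕ → Coprod Δ Z → Prop)
    (hl : ∀ d : Δ, d ≠ 1 → P true true 1 (Coprod.inl d))
    (hr : ∀ d : Z, d ≠ 1 → P false false 1 (Coprod.inr d))
    (hm : ∀ i j k l n m x y, Red i j n x → Red k l m y → j ≠ k → P i j n x → P k l m y →
      P i l (n + m) (x * y))
    {i j n x} (hx : Red i j n x) : P i j n x := by
  obtain ⟨w, rfl, hw⟩ := hx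
  rw [← BF x, ← hw]
  clear hw x
  have key : ∀ {i j} (w : CoprodI.NeWord (Fam Δ) i j), F (B w.prod) = w.prod := by
    intro i j w
    induction w with
    | @singleton i x hx =>
      rw [CoprodI.NeWord.prod_singleton, B_of]
      cases i <;> rfl
    | append w₁ h w₂ h1 h2 => rw [CoprodI.NeWord.append_prod, map_mul, map_mul, h1, h2]
  induction w with
  | @singleton i x hx =>
    rw [CoprodI.NeWord.prod_singleton, B_of]
    cases i
    · exact hr x hx
    · exact hl x hx
  | append w₁ h w₂ h1 h2 =>
    rw [CoprodI.NeWord.append_prod, map_mul, CoprodI.NeWord.toList, List.length_append]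
    exact hm _ _ _ _ _ _ _ _ ⟨w₁, rfl, (key w₁).symm⟩ ⟨w₂, rfl, (key w₂).symm⟩ h h1 h2

lemma Red.comm {n} {x z : Coprod Δ Z} (hz : Red false false n z) (hx : x ≠ 1)
    (h : x * z = z * x) : ∃ m, Red false false m x := by
  obtain ⟨i, j, m, hr⟩ := Red.ex hx
  have a1 : x * z * x⁻¹ = z := by rw [h]; group
  have a2 : x⁻¹ * z * x = z := by rw [mul_assoc, ← h]; group
  cases j
  · cases i
    · exact ⟨m, hr⟩
    · have := ((hr.inv.mul (by simp) hz).mul (by simp) hr)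
      rw [a2] at this
      have := (this.uniq hz).2.2
      have := hr.pos
      omega
  · have := ((hr.mul (by simp) hz).mul (by simp) hr.inv)
    rw [a1] at this
    have := (this.uniq hz).2.2
    have := hr.pos
    omega

lemma Red.head {i j n} {x : Coprod Δ Z} (hx : Red i j n x) :
    (i = true ∧ j = true ∧ ∃ d, x = Coprod.inl d) ∨
      ∃ d m, Red false j m (Coprod.inl d * x) := by
  refine Red.ind (fun i j n x => (i = true ∧ j = true ∧ ∃ d, x = Coprod.inl d) ∨
      ∃ d m, Red false j m (Coprod.inl d * x)) ?_ ?_ ?_ hx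
  · exact fun d hd => Or.inl ⟨rfl, rfl, d, rfl⟩
  · exact fun d hd => Or.inr ⟨1, 1, by simpa using Red.inr hd⟩
  · intro i j k l n m x y hx hy hjk h1 _
    right
    rcases h1 with ⟨rfl, rfl, d, rfl⟩ | ⟨d, p, h⟩
    · refine ⟨d⁻¹, m, ?_⟩
      have : k = false := by cases k <;> simp_all
      subst this
      rw [← mul_assoc, ← map_mul]
      simpa using hy
    · refine ⟨d, p + m, ?_⟩
      rw [← mul_assoc]
      exact h.mul hjk hy

lemma Red.one_right {x : Coprod Δ Z} (hx : Red false false 1 x) : ∃ z, x = Coprod.inr z := by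
  refine Red.ind (fun i j n x => i = false → n = 1 → ∃ z, x = Coprod.inr z) ?_ ?_ ?_ hx rfl rfl
  · intro d _ h; simp at h
  · exact fun d _ _ _ => ⟨d, rfl⟩
  · intro i j k l n m x y hx hy _ _ _ _ h
    have := hx.pos
    have := hy.pos
    omega

lemma zpow_inr (x : Coprod Δ Z) (z : Z) :
    (zpowersHom _ x : Z →* Coprod Δ Z) z = x ^ z.toAdd := rfl

def psi (α : Δ →* Δ) (x : Coprod Δ Z) : Coprod Δ Z →* Coprod Δ Z :=
  Coprod.lift (Coprod.inl.comp α) (zpowersHom _ x)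

/-- exponent sum is a unit -/
lemma snd_unit (α : Δ →* Δ) (x : Coprod Δ Z)
    (hs : Function.Surjective (psi α x)) :
    IsUnit (Coprod.snd x).toAdd := by
  obtain ⟨g, hg⟩ := hs (Coprod.inr (Multiplicative.ofAdd 1))
  have : (Coprod.snd.comp (psi α x)) = (zpowersHom _ (Coprod.snd x)).comp Coprod.snd := by
    apply Coprod.hom_ext
    · ext d; simp [psi]
    · apply MonoidHom.ext; intro d; simp [psi]
  have h := DFunLike.congr_fun this g
  simp only [MonoidHom.comp_apply, hg, Coprod.snd_apply_inr] at h
  have h' := congrArg Multiplicative.toAdd h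
  simp at h'
  exact IsUnit.of_mul_eq_one _ (by rw [mul_comm]; exact h'.symm)

lemma main_red (α : Δ →* Δ) (hα : Function.Injective α) {n} (x : Coprod Δ Z)
    (hs : Function.Surjective (psi α x))
    (hx : Red false false n x) :
    x = tGen Δ ∨ x = (tGen Δ)⁻¹ := by
  have hu := snd_unit α x hs
  have hpow : ∀ z : Z, z ≠ 1 → ∃ m, Red false false m (x ^ z.toAdd) := by
    intro z hz
    apply Red.comm hx
    · intro h
      have h := congrArg Multiplicative.toAdd (congrArg Coprod.snd h)
      simp only [map_zpow, toAdd_zpow, map_one, toAdd_one, smul_eq_mul] at h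
      rcases mul_eq_zero.1 h with h | h
      · exact hz (Multiplicative.toAdd.injective h)
      · rw [h] at hu; simp at hu
    · exact ((Commute.refl x).zpow_left _).eq
  have key : ∀ {i j n g}, Red i j n g → ∃ m, n ≤ m ∧ Red i j m (psi α x g) := by
    intro i j n g hg
    refine Red.ind (fun i j n g => ∃ m, n ≤ m ∧ Red i j m (psi α x g)) ?_ ?_ ?_ hg
    · intro d hd
      refine ⟨1, le_rfl, ?_⟩
      exact Red.inl (fun h => hd (hα (by rw [h, map_one])))
    · intro d hd
      obtain ⟨m, hm⟩ := hpow d hd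
      exact ⟨m, hm.pos, hm⟩
    · rintro i j k l n m x y hx hy hjk ⟨p, hp, h1⟩ ⟨q, hq, h2⟩
      exact ⟨p + q, by omega, by rw [map_mul]; exact h1.mul hjk h2⟩
  obtain ⟨g, hg⟩ := hs (tGen Δ)
  have ht : Red false false 1 (tGen Δ) := Red.inr (by decide)
  have hg1 : g ≠ 1 := by
    rintro rfl
    rw [map_one] at hg
    have := congrArg Coprod.snd hg
    simp [tGen] at this
    exact absurd this (by decide)
  obtain ⟨i, j, n, hr⟩ := Red.ex hg1
  obtain ⟨m, hm, hr'⟩ := key hr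
  rw [hg] at hr'
  obtain ⟨rfl, rfl, rfl⟩ := hr'.uniq ht
  have := hr.pos
  obtain rfl : n = 1 := by omega
  obtain ⟨z, rfl⟩ := hr.one_right
  have hz : x ^ z.toAdd = tGen Δ := hg
  have h := congrArg Multiplicative.toAdd (congrArg Coprod.snd hz)
  have hzu : IsUnit z.toAdd := by
    simp [tGen] at h
    exact IsUnit.of_mul_eq_one _ h
  rcases Int.isUnit_iff.1 hzu with e | e
  · left; rw [e] at hz; simpa using hz
  · right; rw [e] at hz; rw [← hz]; simp

lemma main_gen (α : Δ →* Δ) (hα : Function.Bijective α) (x : Coprod Δ Z)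
    (hs : Function.Surjective (psi α x)) :
    ∃ δ₁ δ₂ : Δ,
      x = Coprod.inl δ₁ * tGen Δ * Coprod.inl δ₂ ∨
      x = Coprod.inl δ₁ * (tGen Δ)⁻¹ * Coprod.inl δ₂ := by
  have hu := snd_unit α x hs
  have hnot : ∀ d : Δ, x ≠ Coprod.inl d := by
    rintro d rfl
    simp at hu
  obtain ⟨i, j, n, hr⟩ := Red.ex (x := x) (by simpa using hnot 1)
  rcases hr.head with ⟨_, _, d, h⟩ | ⟨d, m, h⟩
  · exact absurd h (hnot d)
  rcases h.inv.head with ⟨_, h, _⟩ | ⟨e, p, h⟩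
  · simp at h
  have h := h.inv
  set y := (Coprod.inl e * (Coprod.inl d * x)⁻¹)⁻¹ with hy
  have hy' : x = Coprod.inl d⁻¹ * y * Coprod.inl e := by
    rw [hy, map_inv]; group
  have hsy : Function.Surjective (psi α y) := by
    rw [← MonoidHom.range_eq_top] at hs ⊢
    rw [eq_top_iff, ← hs]
    have hl : ∀ d : Δ, Coprod.inl d ∈ (psi α y).range := by
      intro d
      obtain ⟨d, rfl⟩ := hα.2 d
      exact ⟨Coprod.inl d, rfl⟩
    have hyy : y ∈ (psi α y).range := ⟨Coprod.inr (Multiplicative.ofAdd 1), by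
      simp [psi]⟩
    have hx : x ∈ (psi α y).range := by
      rw [hy']
      exact mul_mem (mul_mem (hl _) hyy) (hl _)
    rintro _ ⟨g, rfl⟩
    induction g using Coprod.induction_on with
    | inl d => exact hl _
    | inr z => exact zpow_mem hx z.toAdd
    | mul a b ha hb => rw [map_mul]; exact mul_mem ha hb
  refine ⟨d⁻¹, e, ?_⟩
  rcases main_red α hα.1 y hsy h with h | h
  · left; rw [← h]; exact hy'
  · right; rw [← h]; exact hy'

end FPZ

/-- Let `Δ` be a co-Hopfian group with no free cyclic (ℤ) free factor, and let
`Γ = Δ ∗ ℤ` with the `ℤ` factor generated by `t`.  If `φ` is an automorphism of `Γ`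
with `φ(Δ) = Δ`, then there are `δ₁, δ₂ ∈ Δ` with `φ(t) = δ₁ t^{±1} δ₂`. -/
theorem aut_of_free_product_with_Z (Δ : Type) [Group Δ]
    (hco : CoHopfian Δ)
    (hnofactor : ¬ ∃ (G : Type) (_ : Group G),
      Nonempty (Δ ≃* Coprod G (Multiplicative ℤ)))
    (φ : Coprod Δ (Multiplicative ℤ) ≃* Coprod Δ (Multiplicative ℤ))
    (hφΔ : Subgroup.map φ.toMonoidHom (Coprod.inl : Δ →* Coprod Δ (Multiplicative ℤ)).range
      = (Coprod.inl : Δ →* Coprod Δ (Multiplicative ℤ)).range) :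
    ∃ δ₁ δ₂ : Δ,
      φ (tGen Δ) = Coprod.inl δ₁ * tGen Δ * Coprod.inl δ₂ ∨
      φ (tGen Δ) = Coprod.inl δ₁ * (tGen Δ)⁻¹ * Coprod.inl δ₂ := by
  have h1 : ∀ d : Δ, ∃ e : Δ, φ (Coprod.inl d) = Coprod.inl e := by
    intro d
    have : φ (Coprod.inl d) ∈ (Coprod.inl : Δ →* Coprod Δ (Multiplicative ℤ)).range := by
      rw [← hφΔ]
      exact ⟨_, ⟨d, rfl⟩, rfl⟩
    obtain ⟨e, he⟩ := this
    exact ⟨e, he.symm⟩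
  let α : Δ →* Δ := (Coprod.fst.comp φ.toMonoidHom).comp Coprod.inl
  have hα : ∀ d, Coprod.inl (α d) = φ (Coprod.inl d) := by
    intro d
    obtain ⟨e, he⟩ := h1 d
    have : α d = Coprod.fst (φ (Coprod.inl d)) := rfl
    rw [this, he, Coprod.fst_apply_inl]
  have hb : Function.Bijective α := by
    constructor
    · intro a b hab
      apply Coprod.inl_injective (N := Multiplicative ℤ)
      apply φ.injective
      rw [← hα, ← hα, hab]
    · intro e
      have : (Coprod.inl e : Coprod Δ (Multiplicative ℤ)) ∈
          Subgroup.map φ.toMonoidHom Coprod.inl.range := by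
        rw [hφΔ]; exact ⟨e, rfl⟩
      obtain ⟨_, ⟨d, rfl⟩, h⟩ := this
      refine ⟨d, Coprod.inl_injective (N := Multiplicative ℤ) ?_⟩
      rw [hα]; exact h
  have hpsi : FPZ.psi α (φ (tGen Δ)) = φ.toMonoidHom := by
    apply Coprod.hom_ext
    · apply MonoidHom.ext; intro d; exact hα d
    · apply MonoidHom.ext_mint
      simp [FPZ.psi, tGen]
  apply FPZ.main_gen α hb
  rw [hpsi]
  exact φ.surjective
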